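/- arXiv:1705.09494 — 2 statements merged into one kernel-verified Lean document; each statement's English description precedes it below -/
import Mathlib

section
/- Let g be the cdf of the standard Skew-Normal distribution with skewness parameter λ > 0, i.e. density f(x) = (2/√(2π)) e^{-x²/2} Φ(λx). Then the quantile function h = g^{-1} satisfies, as u → 0⁺: h(u) = -√(-(2/(1+λ²)) log u) + (log|log u|)/((1+λ²)√(-(2/(1+λ²)) log u)) + (log(2πλ))/((1+λ²)√(-(2/(1+λ²)) log u)) + (log|log u|)²/(2(1+λ²)²(-(2/(1+λ²)) log u)^{3/2}) + O(log|log u|/|log u|^{3/2}). -/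
open Filter Topology Asymptotics Real MeasureTheory

lemma aux_deriv (f G : ℝ → ℝ) (hf : Continuous f) (hi : Integrable f)
    (hG : ∀ x, G x = ∫ t in Set.Iic x, f t) :
    (∀ x, HasDerivAt G (f x) x) ∧ Tendsto G atBot (𝓝 0) := by
  have key : ∀ x, G x = G 0 + ∫ t in (0:ℝ)..x, f t := by
    intro x
    rw [hG, hG, ← intervalIntegral.integral_Iic_sub_Iic hi.integrableOn hi.integrableOn]; ring
  constructor
  · intro x
    have := (intervalIntegral.integral_hasDerivAt_right (hf.intervalIntegrable 0 x)
      (hf.stronglyMeasurableAtFilter _ _) hf.continuousAt).const_add (G 0)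
    exact this.congr_of_eventuallyEq (Eventually.of_forall key)
  · have h1 : Tendsto (fun x => ∫ t in x..(0:ℝ), f t) atBot (𝓝 (∫ t in Set.Iic 0, f t)) :=
      intervalIntegral_tendsto_integral_Iic 0 hi.integrableOn tendsto_id
    have h2 := h1.const_sub (G 0)
    rw [← hG, sub_self] at h2
    refine h2.congr ?_
    intro x
    rw [key x, intervalIntegral.integral_symm]; ring

lemma aux_mono (D D' : ℝ → ℝ) (a : ℝ) (hD : ∀ x < a, HasDerivAt D (D' x) x)
    (hp : ∀ x < a, 0 ≤ D' x) (ht : Tendsto D atBot (𝓝 0)) : ∀ x < a, 0 ≤ D x := by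
  intro x hx
  have hm : MonotoneOn D (Set.Iio a) := by
    apply monotoneOn_of_hasDerivWithinAt_nonneg (f' := D') (convex_Iio a)
    · exact fun y hy => (hD y hy).continuousAt.continuousWithinAt
    · intro y hy
      rw [interior_Iio] at hy
      exact (hD y hy).hasDerivWithinAt
    · intro y hy
      rw [interior_Iio] at hy
      exact hp y hy
  refine le_of_tendsto ht ?_
  filter_upwards [eventually_le_atBot x] with y hy
  exact hm (lt_of_le_of_lt hy hx) hx hy

lemma aux_exp (c : ℝ) (hc : 0 < c) : Tendsto (fun x : ℝ => exp (-(c * x ^ 2 / 2))) atBot (𝓝 0) := by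
  apply tendsto_exp_neg_atTop_nhds_zero.comp
  have : Tendsto (fun x : ℝ => x ^ 2) atBot atTop := by
    have := (tendsto_pow_atTop (α := ℝ) two_ne_zero).comp tendsto_neg_atBot_atTop
    refine this.congr ?_
    intro x; simp
  have h2 := this.const_mul_atTop (show 0 < c / 2 by positivity)
  refine h2.congr ?_
  intro x; ring

lemma aux_expd (c x : ℝ) : HasDerivAt (fun x : ℝ => exp (-(c * x ^ 2 / 2)))
    (exp (-(c * x ^ 2 / 2)) * (-(c * x))) x := by
  have : HasDerivAt (fun x : ℝ => -(c * x ^ 2 / 2)) (-(c * x)) x := by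
    have := ((((hasDerivAt_id x).pow 2).const_mul c).div_const 2).neg
    refine this.congr_deriv ?_
    simp; ring
  exact this.exp

lemma aux_invd (n : ℕ) (x : ℝ) (hx : x ≠ 0) : HasDerivAt (fun x : ℝ => (x⁻¹) ^ n)
    (-(n * (x⁻¹) ^ (n + 1))) x := by
  have := (hasDerivAt_inv hx).pow n
  refine this.congr_deriv ?_
  rcases n with _ | n
  · simp
  · simp only [inv_pow, Nat.add_sub_cancel]; field_simp; ring

lemma aux_inv (n : ℕ) (hn : n ≠ 0) : Tendsto (fun x : ℝ => (x⁻¹) ^ n) atBot (𝓝 0) := by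
  have := (tendsto_inv_atBot_zero (𝕜 := ℝ)).pow n
  simpa [hn] using this

/-- Mills ratio bounds -/
lemma mills (Φ : ℝ → ℝ)
    (hd : ∀ x, HasDerivAt Φ (exp (-(1 * x ^ 2 / 2)) / √(2 * π)) x) (h0 : Tendsto Φ atBot (𝓝 0)) :
    ∀ x < 0, Φ x ≤ exp (-(1 * x ^ 2 / 2)) / √(2 * π) * (-x⁻¹) ∧
      exp (-(1 * x ^ 2 / 2)) / √(2 * π) * (-x⁻¹ + (x⁻¹) ^ 3) ≤ Φ x := by
  intro x hx
  have hs : 0 < √(2 * π) := by positivity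
  constructor
  · have := aux_mono (fun x => exp (-(1 * x ^ 2 / 2)) * (-(x⁻¹) ^ 1) / √(2 * π) - Φ x)
      _ 0 (fun x hx => (((aux_expd 1 x).mul (aux_invd 1 x hx.ne).neg).div_const _).sub (hd x))
      ?_ ?_ x hx
    · simp only [pow_one] at this
      calc _ ≤ _ := sub_nonneg.1 this
        _ = _ := by ring
    · intro x hx
      have hx0 := hx.ne
      try simp only [Pi.neg_apply, Pi.add_apply, Pi.sub_apply]
      rw [← sub_div]
      apply div_nonneg _ hs.le
      have : exp (-(1 * x ^ 2 / 2)) * -(1 * x) * -x⁻¹ ^ 1 + exp (-(1 * x ^ 2 / 2)) * - -(((1:ℕ):ℝ) * x⁻¹ ^ (1 + 1)) - exp (-(1 * x ^ 2 / 2)) = exp (-(1 * x ^ 2 / 2)) * x⁻¹ ^ 2 := by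
        simp only [inv_pow, Nat.cast_ofNat, Nat.cast_one, Nat.reduceAdd]; field_simp; ring
      rw [this]; positivity
    · have := (((aux_exp 1 one_pos).mul (aux_inv 1 one_ne_zero).neg).div_const (√(2 * π))).sub h0
      simpa using this
  · have := aux_mono (fun x => Φ x - exp (-(1 * x ^ 2 / 2)) * (-(x⁻¹) ^ 1 + (x⁻¹) ^ 3) / √(2 * π))
      _ 0 (fun x hx => (hd x).sub
       (((aux_expd 1 x).mul ((aux_invd 1 x hx.ne).neg.add (aux_invd 3 x hx.ne))).div_const _))
      ?_ ?_ x hx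
    · simp only [pow_one] at this
      calc _ = _ := by ring
        _ ≤ _ := sub_nonneg.1 this
    · intro x hx
      have hx0 := hx.ne
      try simp only [Pi.neg_apply, Pi.add_apply, Pi.sub_apply]
      rw [← sub_div]
      apply div_nonneg _ hs.le
      have : exp (-(1 * x ^ 2 / 2)) - (exp (-(1 * x ^ 2 / 2)) * -(1 * x) * (-x⁻¹ ^ 1 + x⁻¹ ^ 3) + exp (-(1 * x ^ 2 / 2)) * (- -(((1:ℕ):ℝ) * x⁻¹ ^ (1 + 1)) + -(((3:ℕ):ℝ) * x⁻¹ ^ (3 + 1)))) = exp (-(1 * x ^ 2 / 2)) * (3 * x⁻¹ ^ 4) := by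
        simp only [inv_pow, Nat.cast_ofNat, Nat.cast_one, Nat.reduceAdd]; field_simp; ring
      rw [this]; positivity
    · have := h0.sub (((aux_exp 1 one_pos).mul ((aux_inv 1 one_ne_zero).neg.add (aux_inv 3 three_ne_zero))).div_const (√(2 * π)))
      simpa using this

/-- tail bounds for the skew normal cdf -/
lemma tail (Φ g : ℝ → ℝ) (l : ℝ) (hl : 0 < l)
    (hm : ∀ x < 0, Φ x ≤ exp (-(1 * x ^ 2 / 2)) / √(2 * π) * (-x⁻¹) ∧
      exp (-(1 * x ^ 2 / 2)) / √(2 * π) * (-x⁻¹ + (x⁻¹) ^ 3) ≤ Φ x)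
    (hd : ∀ x, HasDerivAt g ((2 / √(2 * π)) * exp (-x ^ 2 / 2) * Φ (l * x)) x)
    (h0 : Tendsto g atBot (𝓝 0)) :
    ∀ x < 0, g x ≤ exp (-((1 + l ^ 2) * x ^ 2 / 2)) * ((x⁻¹) ^ 2) / (π * l * (1 + l ^ 2)) ∧
     exp (-((1 + l ^ 2) * x ^ 2 / 2)) * ((x⁻¹) ^ 2 - (2 / (1 + l ^ 2) + 1 / l ^ 2) * (x⁻¹) ^ 4)
       / (π * l * (1 + l ^ 2)) ≤ g x := by
  intro x hx
  have hc : 0 < 1 + l ^ 2 := by positivity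
  have hs : 0 < √(2 * π) := by positivity
  have hp := Real.pi_pos
  have hee : ∀ x, (2 / √(2 * π)) * exp (-x ^ 2 / 2) * (exp (-(1 * (l * x) ^ 2 / 2)) / √(2 * π)) =
      exp (-((1 + l ^ 2) * x ^ 2 / 2)) / π := by
    intro x
    have h1 : √(2 * π) * √(2 * π) = 2 * π := Real.mul_self_sqrt (by positivity)
    have h2 : exp (-((1 + l ^ 2) * x ^ 2 / 2)) = exp (-x ^ 2 / 2) * exp (-(1 * (l * x) ^ 2 / 2)) := by
      rw [← exp_add]; congr 1; ring
    rw [h2]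
    calc _ = 2 / (√(2 * π) * √(2 * π)) * (exp (-x ^ 2 / 2) * exp (-(1 * (l * x) ^ 2 / 2))) := by
            field_simp
      _ = _ := by rw [h1]; field_simp
  constructor
  · have := aux_mono (fun x => exp (-((1 + l ^ 2) * x ^ 2 / 2)) * ((x⁻¹) ^ 2) / (π * l * (1 + l ^ 2)) - g x)
      _ 0 (fun x hx => (((aux_expd _ x).mul (aux_invd 2 x hx.ne)).div_const _).sub (hd x))
      ?_ ?_ x hx
    · exact sub_nonneg.1 this
    · intro x hx
      have hx0 := hx.ne
      try simp only [Pi.neg_apply, Pi.add_apply, Pi.sub_apply]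
      have hlx : l * x < 0 := mul_neg_of_pos_of_neg hl hx
      have hb : (2 / √(2 * π)) * exp (-x ^ 2 / 2) * Φ (l * x) ≤
          exp (-((1 + l ^ 2) * x ^ 2 / 2)) / π * (-(l * x)⁻¹) := by
        rw [← hee, mul_assoc (2 / √(2 * π) * exp (-x ^ 2 / 2))]
        exact mul_le_mul_of_nonneg_left (hm _ hlx).1 (by positivity)
      have hy : 0 < (-x)⁻¹ := inv_pos.2 (neg_pos.2 hx)
      have he := exp_pos (-((1 + l ^ 2) * x ^ 2 / 2))
      have : (exp (-((1 + l ^ 2) * x ^ 2 / 2)) * -((1 + l ^ 2) * x) * x⁻¹ ^ 2 + exp (-((1 + l ^ 2) * x ^ 2 / 2)) * -(((2:ℕ):ℝ) * x⁻¹ ^ (2 + 1))) / (π * l * (1 + l ^ 2)) - exp (-((1 + l ^ 2) * x ^ 2 / 2)) / π * (-(l * x)⁻¹) = exp (-((1 + l ^ 2) * x ^ 2 / 2)) * (2 * (-x)⁻¹ ^ 3) / (π * l * (1 + l ^ 2)) := by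
        rw [inv_neg]
        simp only [mul_pow, inv_pow, Nat.cast_ofNat, Nat.cast_one, Nat.reduceAdd]; field_simp; ring
      have h3 : 0 ≤ exp (-((1 + l ^ 2) * x ^ 2 / 2)) * (2 * (-x)⁻¹ ^ 3) / (π * l * (1 + l ^ 2)) := by positivity
      linarith
    · have := (((aux_exp _ hc).mul (aux_inv 2 two_ne_zero)).div_const (π * l * (1 + l ^ 2))).sub h0
      simpa using this
  · have := aux_mono (fun x => g x - exp (-((1 + l ^ 2) * x ^ 2 / 2)) * ((x⁻¹) ^ 2 - (2 / (1 + l ^ 2) + 1 / l ^ 2) * (x⁻¹) ^ 4)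
       / (π * l * (1 + l ^ 2)))
      _ 0 (fun x hx => (hd x).sub (((aux_expd _ x).mul ((aux_invd 2 x hx.ne).sub ((aux_invd 4 x hx.ne).const_mul _))).div_const _))
      ?_ ?_ x hx
    · exact sub_nonneg.1 this
    · intro x hx
      have hx0 := hx.ne
      try simp only [Pi.neg_apply, Pi.add_apply, Pi.sub_apply]
      have hlx : l * x < 0 := mul_neg_of_pos_of_neg hl hx
      have hb : exp (-((1 + l ^ 2) * x ^ 2 / 2)) / π * (-(l * x)⁻¹ + ((l * x)⁻¹) ^ 3) ≤
         (2 / √(2 * π)) * exp (-x ^ 2 / 2) * Φ (l * x) := by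
        rw [← hee, mul_assoc (2 / √(2 * π) * exp (-x ^ 2 / 2))]
        exact mul_le_mul_of_nonneg_left (hm _ hlx).2 (by positivity)
      have hy : 0 < (-x)⁻¹ := inv_pos.2 (neg_pos.2 hx)
      have he := exp_pos (-((1 + l ^ 2) * x ^ 2 / 2))
      have : exp (-((1 + l ^ 2) * x ^ 2 / 2)) / π * (-(l * x)⁻¹ + ((l * x)⁻¹) ^ 3) - (exp (-((1 + l ^ 2) * x ^ 2 / 2)) * -((1 + l ^ 2) * x) * (x⁻¹ ^ 2 - (2 / (1 + l ^ 2) + 1 / l ^ 2) * (x⁻¹) ^ 4) + exp (-((1 + l ^ 2) * x ^ 2 / 2)) * (-(((2:ℕ):ℝ) * x⁻¹ ^ (2 + 1)) - (2 / (1 + l ^ 2) + 1 / l ^ 2) * -(((4:ℕ):ℝ) * x⁻¹ ^ (4 + 1)))) / (π * l * (1 + l ^ 2)) = exp (-((1 + l ^ 2) * x ^ 2 / 2)) * (4 * (2 / (1 + l ^ 2) + 1 / l ^ 2) * (-x)⁻¹ ^ 5) / (π * l * (1 + l ^ 2)) := by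
        rw [inv_neg]
        simp only [mul_pow, inv_pow, Nat.cast_ofNat, Nat.cast_one, Nat.reduceAdd]; field_simp; ring
      have h3 : 0 ≤ exp (-((1 + l ^ 2) * x ^ 2 / 2)) * (4 * (2 / (1 + l ^ 2) + 1 / l ^ 2) * (-x)⁻¹ ^ 5) / (π * l * (1 + l ^ 2)) := by positivity
      linarith
    · have := h0.sub (((aux_exp _ hc).mul ((aux_inv 2 two_ne_zero).sub ((aux_inv 4 four_ne_zero).const_mul (2 / (1 + l ^ 2) + 1 / l ^ 2)))).div_const (π * l * (1 + l ^ 2)))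
      simpa using this

/-- logs of two-sided tail bounds -/
lemma tail_log (g : ℝ → ℝ) (l : ℝ) (hl : 0 < l)
    (ht : ∀ x < 0, g x ≤ exp (-((1 + l ^ 2) * x ^ 2 / 2)) * ((x⁻¹) ^ 2) / (π * l * (1 + l ^ 2)) ∧
     exp (-((1 + l ^ 2) * x ^ 2 / 2)) * ((x⁻¹) ^ 2 - (2 / (1 + l ^ 2) + 1 / l ^ 2) * (x⁻¹) ^ 4)
       / (π * l * (1 + l ^ 2)) ≤ g x) :
    ∃ C : ℝ, 0 < C ∧ ∀ᶠ x in atBot, 0 < g x ∧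
      |-log (g x) - (1 + l ^ 2) * x ^ 2 / 2 - log (2 * π * l) - log ((1 + l ^ 2) * x ^ 2 / 2)| ≤
        C / ((1 + l ^ 2) * x ^ 2 / 2) := by
  have hc : 0 < 1 + l ^ 2 := by positivity
  have hp := Real.pi_pos
  set B := 2 / (1 + l ^ 2) + 1 / l ^ 2 with hB
  have hB0 : 0 < B := by positivity
  refine ⟨B * (1 + l ^ 2), by positivity, ?_⟩
  filter_upwards [eventually_lt_atBot (0:ℝ), eventually_lt_atBot (-(2 * B)), eventually_lt_atBot (-1)] with x hx hxB hx1
  obtain ⟨h1, h2⟩ := ht x hx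
  have hx2 : 0 < x ^ 2 := by nlinarith
  have hxx : 2 * B ≤ x ^ 2 := by nlinarith
  set A := exp (-((1 + l ^ 2) * x ^ 2 / 2)) * ((x⁻¹) ^ 2) / (π * l * (1 + l ^ 2)) with hA
  have hx0 := hx.ne
  have hA0 : 0 < A := by have : 0 < x⁻¹ ^ 2 := by rw [inv_pow]; positivity
                         positivity
  have h2' : A * (1 - B / x ^ 2) ≤ g x := by
    refine le_trans (le_of_eq ?_) h2
    rw [hA]; field_simp
  have hle : B / x ^ 2 ≤ 1 / 2 := by rw [div_le_iff₀ hx2]; linarith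
  have hge : 0 < B / x ^ 2 := by positivity
  have hgp : 0 < g x := lt_of_lt_of_le (mul_pos hA0 (by linarith)) h2'
  refine ⟨hgp, ?_⟩
  have hlA : log A = -((1 + l ^ 2) * x ^ 2 / 2) - log (2 * π * l) - log ((1 + l ^ 2) * x ^ 2 / 2) := by
    have : A = exp (-((1 + l ^ 2) * x ^ 2 / 2)) / (2 * π * l) / ((1 + l ^ 2) * x ^ 2 / 2) := by
      rw [hA]; field_simp
    rw [this, log_div (by positivity) (by positivity), log_div (by positivity) (by positivity), log_exp]
  have e1 : -log (g x) - (1 + l ^ 2) * x ^ 2 / 2 - log (2 * π * l) - log ((1 + l ^ 2) * x ^ 2 / 2)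
     = log A - log (g x) := by rw [hlA]; ring
  rw [e1, abs_of_nonneg (sub_nonneg.2 (log_le_log hgp h1)), ← log_div hA0.ne' hgp.ne']
  refine (log_le_sub_one_of_pos (by positivity)).trans ?_
  have e2 : B * (1 + l ^ 2) / ((1 + l ^ 2) * x ^ 2 / 2) = 2 * (B / x ^ 2) := by field_simp
  rw [e2, sub_le_iff_le_add, div_le_iff₀ hgp]
  set b := B / x ^ 2
  have : A ≤ (2 * b + 1) * (A * (1 - b)) := by nlinarith [mul_nonneg hA0.le (mul_nonneg hge.le (sub_nonneg.2 hle))]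
  refine this.trans (mul_le_mul_of_nonneg_left h2' (by linarith))

lemma core_alg (c K C X y q s ℓ : ℝ) (hc : 0 < c) (hX0 : 0 < X) (hL1 : 1 ≤ X) (hl1 : 1 ≤ ℓ)
    (hq' : q = c * y ^ 2 / 2) (hs0 : 0 < s) (hXs : X = c * s ^ 2 / 2) (hy0 : 0 ≤ y)
    (ha : (1 + |K|) * ℓ ≤ 1 / 4 * X) (hb : ℓ ^ 2 ≤ X)
    (hR : |q - X + ℓ + K| ≤ (4 + 2 * C) * (ℓ / X)) :
    |y - (s - ℓ / (c * s) - K / (c * s) - ℓ ^ 2 / (2 * c ^ 2 * s ^ 3))| * (s / 2) ≤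
      (2 / c * (4 + 2 * C) + (2 * |K| + K ^ 2) / (2 * c) + (1 + |K|) / (4 * c) + 1 / (32 * c)) * (ℓ / X) := by
  set P := s - ℓ / (c * s) - K / (c * s) - ℓ ^ 2 / (2 * c ^ 2 * s ^ 3) with hP
  have hℓ0 : 0 ≤ ℓ := by linarith
  have hk := abs_le.1 (le_refl |K|)
  have hPs : s / 2 ≤ P := by
    have e : P = s * (1 - (ℓ + K) / (2 * X) - ℓ ^ 2 / (8 * X ^ 2)) := by
      rw [hP, hXs]; field_simp; ring
    have e1 : (ℓ + K) / (2 * X) ≤ 1 / 8 := by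
      rw [div_le_iff₀ (by positivity)]
      nlinarith [abs_nonneg K]
    have e2 : ℓ ^ 2 / (8 * X ^ 2) ≤ 1 / 8 := by
      rw [div_le_iff₀ (by positivity)]
      nlinarith
    rw [e]; nlinarith
  have hyP : y ^ 2 - P ^ 2 = 2 / c * (q - X + ℓ + K) - (2 * K * ℓ + K ^ 2) / (2 * c * X)
      - (ℓ + K) * ℓ ^ 2 / (4 * c * X ^ 2) - ℓ ^ 4 / (32 * c * X ^ 3) := by
    rw [hP, hq', hXs]; field_simp; ring
  have t1 : |(2 * K * ℓ + K ^ 2) / (2 * c * X)| ≤ (2 * |K| + K ^ 2) / (2 * c) * (ℓ / X) := by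
    rw [abs_div, abs_of_pos (show 0 < 2 * c * X by positivity), div_mul_div_comm]
    gcongr
    refine (abs_add_le _ _).trans ?_
    rw [abs_mul, abs_mul, abs_of_nonneg hℓ0, abs_of_nonneg (sq_nonneg K), abs_two]
    nlinarith [sq_nonneg K]
  have t2 : |(ℓ + K) * ℓ ^ 2 / (4 * c * X ^ 2)| ≤ (1 + |K|) / (4 * c) * (ℓ / X) := by
    have e : (1 + |K|) / (4 * c) * (ℓ / X) = ((1 + |K|) * ℓ) * X / (4 * c * X ^ 2) := by field_simp
    rw [e, abs_div, abs_of_pos (show 0 < 4 * c * X ^ 2 by positivity), abs_mul, abs_of_nonneg (sq_nonneg ℓ)]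
    gcongr
    refine (abs_add_le _ _).trans ?_
    rw [abs_of_nonneg hℓ0]
    nlinarith [abs_nonneg K]
  have t3 : |ℓ ^ 4 / (32 * c * X ^ 3)| ≤ 1 / (32 * c) * (ℓ / X) := by
    have e : 1 / (32 * c) * (ℓ / X) = ℓ * X ^ 2 / (32 * c * X ^ 3) := by field_simp
    rw [e, abs_of_nonneg (by positivity)]
    gcongr
    have : ℓ ^ 4 ≤ X ^ 2 := by
      calc ℓ ^ 4 = (ℓ ^ 2) ^ 2 := by ring
        _ ≤ X ^ 2 := by gcongr
    nlinarith [sq_nonneg X]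
  have t0 : |2 / c * (q - X + ℓ + K)| ≤ 2 / c * (4 + 2 * C) * (ℓ / X) := by
    rw [abs_mul, abs_of_pos (show 0 < 2 / c by positivity), mul_assoc]
    gcongr
  set N := (2 / c * (4 + 2 * C) + (2 * |K| + K ^ 2) / (2 * c) + (1 + |K|) / (4 * c) + 1 / (32 * c)) with hN
  have hmain : |y ^ 2 - P ^ 2| ≤ N * (ℓ / X) := by
    rw [hyP, hN, abs_le]
    have a0 := abs_le.1 t0
    have a1 := abs_le.1 t1
    have a2 := abs_le.1 t2
    have a3 := abs_le.1 t3
    constructor <;> linarith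
  have hfac : |y - P| * (s / 2) ≤ N * (ℓ / X) := by
    calc |y - P| * (s / 2) ≤ |y - P| * (y + P) := by gcongr; linarith
      _ = |y ^ 2 - P ^ 2| := by
        rw [← abs_of_nonneg (show 0 ≤ y + P by linarith), ← abs_mul]
        congr 1; ring
      _ ≤ _ := hmain
  exact hfac

lemma core_pt (c K C X y : ℝ) (hc : 0 < c) (hC : 0 < C)
    (hE : |X - c * y ^ 2 / 2 - K - log (c * y ^ 2 / 2)| ≤ C / (c * y ^ 2 / 2))
    (hq1 : c * y ^ 2 / 2 ≤ X) (hq2 : X ≤ 2 * (c * y ^ 2 / 2))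
    (hq3 : X - c * y ^ 2 / 2 ≤ 2 * log (c * y ^ 2 / 2)) (hl1 : 1 ≤ log X) (hL1 : 1 ≤ X)
    (ha : (1 + |K|) * log X ≤ 1 / 4 * X) (hb : log X ^ 2 ≤ X) (hq5 : 1 ≤ c * y ^ 2 / 2) (hy0 : 0 ≤ y) :
    |y - (√(2 / c * X) - log X / (c * √(2 / c * X)) - K / (c * √(2 / c * X))
        - (log X) ^ 2 / (2 * c ^ 2 * √(2 / c * X) ^ 3))| ≤
     (2 / c * (4 + 2 * C) + (2 * |K| + K ^ 2) / (2 * c) + (1 + |K|) / (4 * c) + 1 / (32 * c)) * 2 / √(2 / c) * (log X / (X * √X)) := by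
  set q := c * y ^ 2 / 2 with hqd
  set ℓ := log (X) with hℓ
  have hX0 : 0 < X := by linarith
  have hq0 : 0 < q := by linarith
  -- R bound
  have hlogle : log q ≤ ℓ := log_le_log hq0 hq1
  have hdl : ℓ - log q ≤ 4 * (ℓ / X) := by
    rw [hℓ, ← log_div hX0.ne' hq0.ne']
    refine (log_le_sub_one_of_pos (by positivity)).trans ?_
    rw [← hℓ, ← mul_div_assoc, le_div_iff₀ hX0]
    have e : X / q - 1 = (X - q) / q := by field_simp
    rw [e, div_mul_eq_mul_div, div_le_iff₀ hq0]
    have : 0 ≤ log q := log_nonneg hq5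
    nlinarith [mul_nonneg (sub_nonneg.2 hq3) hX0.le, mul_nonneg (sub_nonneg.2 hlogle) hX0.le, mul_nonneg (sub_nonneg.2 hq2) (show 0 ≤ ℓ by linarith)]
  have hCq : C / q ≤ 2 * C * (ℓ / X) := by
    rw [← mul_div_assoc, div_le_div_iff₀ hq0 hX0]
    nlinarith [mul_nonneg hC.le (sub_nonneg.2 hq2), mul_nonneg (mul_nonneg hC.le hq0.le) (sub_nonneg.2 hl1)]
  have hR : |q - X + ℓ + K| ≤ (4 + 2 * C) * (ℓ / X) := by
    have := abs_le.1 (hE.trans hCq)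
    rw [abs_le]; constructor
    · nlinarith
    · nlinarith
  set s := √(2 / c * X) with hs
  have hs0 : 0 < s := by positivity
  have hs2 : s ^ 2 = 2 / c * X := Real.sq_sqrt (by positivity)
  have hXs : X = c * s ^ 2 / 2 := by rw [hs2]; field_simp
  have hfac := core_alg c K C X y q s ℓ hc hX0 hL1 hl1 hqd hs0 hXs hy0 ha hb hR
  set P := (s - ℓ / (c * s) - K / (c * s) - ℓ ^ 2 / (2 * c ^ 2 * s ^ 3)) with hP
  set N := (2 / c * (4 + 2 * C) + (2 * |K| + K ^ 2) / (2 * c) + (1 + |K|) / (4 * c) + 1 / (32 * c)) with hN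
  have hss : s = √(2 / c) * √X := Real.sqrt_mul (by positivity) _
  have hr : 0 < √(2 / c) := by positivity
  have hrX : 0 < √X := by positivity
  calc |y - P| = |y - P| * (s / 2) / (s / 2) := by field_simp
    _ ≤ N * (ℓ / X) / (s / 2) := by gcongr
    _ = _ := by rw [hss]; field_simp

lemma core {α : Type*} (F : Filter α) (c K C : ℝ) (hc : 0 < c) (hC : 0 < C) (y L : α → ℝ)
    (hy : Tendsto y F atTop)
    (hE : ∀ᶠ u in F, |L u - c * y u ^ 2 / 2 - K - log (c * y u ^ 2 / 2)| ≤ C / (c * y u ^ 2 / 2)) :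
    ∃ M, ∀ᶠ u in F, 1 ≤ L u ∧ 0 ≤ log (L u) ∧
      |y u - (√(2 / c * L u) - log (L u) / (c * √(2 / c * L u)) - K / (c * √(2 / c * L u))
        - (log (L u)) ^ 2 / (2 * c ^ 2 * √(2 / c * L u) ^ 3))| ≤ M * (log (L u) / (L u * √(L u))) := by
  have hq : Tendsto (fun u => c * y u ^ 2 / 2) F atTop := by
    have := ((tendsto_pow_atTop (α := ℝ) two_ne_zero).comp hy).const_mul_atTop (show 0 < c / 2 by positivity)
    refine this.congr ?_
    intro x; simp; ring
  have hlq := tendsto_log_atTop.comp hq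
  have hlo : ∀ᶠ t : ℝ in atTop, log t ≤ 1 / 2 * t := by
    have := isLittleO_log_id_atTop.bound (show (0:ℝ) < 1/2 by norm_num)
    filter_upwards [this, eventually_ge_atTop 1] with t ht h1
    rw [norm_eq_abs, norm_eq_abs, id, abs_of_nonneg (log_nonneg h1), abs_of_nonneg (by linarith)] at ht
    exact ht
  have hlo2 : ∀ᶠ t : ℝ in atTop, (1 + |K|) * log t ≤ 1 / 4 * t ∧ log t ^ 2 ≤ t := by
    have h1 := isLittleO_log_id_atTop.bound (show (0:ℝ) < 1/(4 * (1 + |K|)) by positivity)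
    have h2 := (isLittleO_pow_log_id_atTop (n := 2)).bound (show (0:ℝ) < 1 by norm_num)
    filter_upwards [h1, h2, eventually_ge_atTop 1] with t h1 h2 h3
    rw [norm_eq_abs, norm_eq_abs, id, abs_of_nonneg (log_nonneg h3), abs_of_nonneg (show 0 ≤ t by linarith)] at h1
    rw [norm_eq_abs, norm_eq_abs, id, abs_of_nonneg (sq_nonneg _), abs_of_nonneg (show 0 ≤ t by linarith), one_mul] at h2
    refine ⟨?_, h2⟩
    have : 0 < 1 + |K| := by positivity
    calc _ ≤ (1 + |K|) * (1/(4 * (1 + |K|)) * t) := by gcongr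
      _ = _ := by field_simp
  -- basic comparison
  have hqL : ∀ᶠ u in F, c * y u ^ 2 / 2 ≤ L u ∧ L u ≤ 2 * (c * y u ^ 2 / 2) ∧
      L u - c * y u ^ 2 / 2 ≤ 2 * log (c * y u ^ 2 / 2) ∧ C / (c * y u ^ 2 / 2) ≤ 1 := by
    have h2 : ∀ᶠ t : ℝ in atTop, 2 * log t ≤ t := by
      filter_upwards [hlo] with t ht; linarith
    filter_upwards [hE, hq.eventually h2, hlq.eventually_ge_atTop (|K| + 1), hq.eventually_ge_atTop (max C 1)] with u h1 h2 h3 h4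
    simp only [Function.comp] at h3
    set q := c * y u ^ 2 / 2
    have hq0 : 0 < q := lt_of_lt_of_le hC ((le_max_left _ _).trans h4)
    have h5 : C / q ≤ 1 := (div_le_one hq0).2 ((le_max_left _ _).trans h4)
    have := abs_le.1 (h1.trans h5)
    have hk := abs_le.1 (le_refl |K|)
    refine ⟨by linarith, by linarith, by linarith, h5⟩
  have hL : Tendsto L F atTop := tendsto_atTop_mono' F (hqL.mono fun u h => h.1) hq
  have hlL := tendsto_log_atTop.comp hL
  refine ⟨(2 / c * (4 + 2 * C) + (2 * |K| + K ^ 2) / (2 * c) + (1 + |K|) / (4 * c) + 1 / (32 * c)) * 2 / √(2 / c), ?_⟩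
  filter_upwards [hE, hqL, hlL.eventually_ge_atTop 1, hL.eventually_ge_atTop 1, hL.eventually hlo2,
    hq.eventually_ge_atTop 1, hy.eventually_ge_atTop 0] with u hE ⟨hq1, hq2, hq3, hq4⟩ hl1 hL1 ⟨ha, hb⟩ hq5 hy0
  simp only [Function.comp] at hl1
  refine ⟨hL1, by linarith, ?_⟩
  exact core_pt c K C (L u) (y u) hc hC hE hq1 hq2 hq3 hl1 hL1 ha hb hq5 hy0

/-- Lower quantile expansion for the standard Skew-Normal distribution with
positive skewness parameter λ. -/
theorem skew_normal_quantile_expansion_pos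
    (Φ g h : ℝ → ℝ) (l : ℝ) (hl : 0 < l)
    (hΦ : ∀ x, Φ x = ∫ t in Set.Iic x, Real.exp (-t ^ 2 / 2) / Real.sqrt (2 * Real.pi))
    (hg : ∀ x, g x = ∫ t in Set.Iic x,
      (2 / Real.sqrt (2 * Real.pi)) * Real.exp (-t ^ 2 / 2) * Φ (l * t))
    (hinv : ∀ u ∈ Set.Ioo (0:ℝ) 1, g (h u) = u) :
    (fun u => h u -
      (-Real.sqrt (-(2 / (1 + l ^ 2)) * Real.log u)
        + Real.log |Real.log u| /
            ((1 + l ^ 2) * Real.sqrt (-(2 / (1 + l ^ 2)) * Real.log u))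
        + Real.log (2 * Real.pi * l) /
            ((1 + l ^ 2) * Real.sqrt (-(2 / (1 + l ^ 2)) * Real.log u))
        + (Real.log |Real.log u|) ^ 2 /
            (2 * (1 + l ^ 2) ^ 2 * (-(2 / (1 + l ^ 2)) * Real.log u) ^ ((3:ℝ) / 2))))
      =O[𝓝[>] (0:ℝ)]
    (fun u => Real.log |Real.log u| / |Real.log u| ^ ((3:ℝ) / 2)) := by
  have hc : 0 < 1 + l ^ 2 := by positivity
  have hp := Real.pi_pos
  -- Φ
  have hφc : Continuous (fun t : ℝ => exp (-t ^ 2 / 2) / √(2 * π)) := by fun_prop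
  have hφi : Integrable (fun t : ℝ => exp (-t ^ 2 / 2) / √(2 * π)) := by
    refine ((integrable_exp_neg_mul_sq (show (0:ℝ) < 1 / 2 by norm_num)).div_const (√(2 * π))).congr ?_
    refine Eventually.of_forall fun t => ?_
    simp only
    congr 2; ring
  obtain ⟨hΦd, hΦ0⟩ := aux_deriv _ Φ hφc hφi hΦ
  have hΦc : Continuous Φ := continuous_iff_continuousAt.2 fun x => (hΦd x).continuousAt
  have hΦnn : ∀ x, 0 ≤ Φ x := fun x => by
    rw [hΦ]; exact integral_nonneg fun t => by positivity
  have hΦle : ∀ x, Φ x ≤ ∫ t, exp (-t ^ 2 / 2) / √(2 * π) := fun x => by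
    rw [hΦ]; exact setIntegral_le_integral hφi (Eventually.of_forall fun t => by positivity)
  have hm := mills Φ (fun x => by
    have := hΦd x
    rwa [show -x ^ 2 / 2 = -(1 * x ^ 2 / 2) by ring] at this) hΦ0
  -- g
  have hfc : Continuous (fun t : ℝ => (2 / √(2 * π)) * exp (-t ^ 2 / 2) * Φ (l * t)) := by fun_prop
  have hfi : Integrable (fun t : ℝ => (2 / √(2 * π)) * exp (-t ^ 2 / 2) * Φ (l * t)) := by
    have h1 : Integrable (fun t : ℝ => (2 / √(2 * π)) * exp (-t ^ 2 / 2)) := by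
      refine (hφi.const_mul 2).congr (Eventually.of_forall fun t => ?_)
      simp only
      ring
    refine h1.mul_bdd (c := ∫ t, exp (-t ^ 2 / 2) / √(2 * π)) (by fun_prop) ?_
    refine Eventually.of_forall fun t => ?_
    rw [norm_eq_abs, abs_of_nonneg (hΦnn _)]
    exact hΦle _
  obtain ⟨hgd, hg0⟩ := aux_deriv _ g hfc hfi hg
  have hgm : Monotone g := monotone_of_hasDerivAt_nonneg hgd fun x => by
    have := hΦnn (l * x)
    simp only [Pi.zero_apply]
    positivity
  obtain ⟨C, hC, hT⟩ := tail_log g l hl (tail Φ g l hl hm hgd hg0)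
  -- h tends to -∞
  have hu1 : ∀ᶠ u : ℝ in 𝓝[>] 0, u ∈ Set.Ioo (0:ℝ) 1 := Ioo_mem_nhdsGT one_pos
  have hh : Tendsto h (𝓝[>] 0) atBot := by
    rw [tendsto_atBot]
    intro b
    obtain ⟨x, hx, hxb⟩ := (hT.and (eventually_le_atBot b)).exists
    filter_upwards [hu1, Ioo_mem_nhdsGT hx.1] with u hu hux
    by_contra hcon
    have := hgm (hxb.trans (not_le.1 hcon).le)
    rw [hinv u hu] at this
    exact absurd hux.2 (not_lt.2 this)
  have hE := hh.eventually hT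
  obtain ⟨M, hM⟩ := core (𝓝[>] (0:ℝ)) (1 + l ^ 2) (log (2 * π * l)) C hc hC (fun u => -h u)
    (fun u => -log u) (tendsto_neg_atBot_atTop.comp hh) (by
      filter_upwards [hE, hu1] with u h1 hu
      have := h1.2
      rw [hinv u hu] at this
      simpa only [neg_sq] using this)
  refine IsBigO.of_bound M ?_
  filter_upwards [hM] with u ⟨hL1, hl0, hb⟩
  have hL0 : 0 < -log u := by linarith
  have e1 : |log u| = -log u := abs_of_neg (by linarith)
  have e2 : -(2 / (1 + l ^ 2)) * log u = 2 / (1 + l ^ 2) * -log u := by ring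
  have e3 : ∀ z : ℝ, 0 < z → z ^ ((3:ℝ) / 2) = √z ^ 3 := fun z hz => by
    rw [sqrt_eq_rpow, ← rpow_natCast, ← rpow_mul hz.le]; norm_num
  have e4 : √(-log u) ^ 3 = -log u * √(-log u) := by
    rw [pow_succ, Real.sq_sqrt hL0.le]
  rw [e1, e2, e3 _ hL0, e3 _ (by positivity), e4, norm_eq_abs, norm_eq_abs,
    abs_of_nonneg (a := log (-log u) / (-log u * √(-log u))) (by positivity)]
  refine le_trans (le_of_eq ?_) hb
  rw [← abs_neg]
  congr 1
  ring
end

section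
/- Let g be the cdf of the standard Skew-Normal distribution with skewness parameter λ < 0. Then the quantile function h = g^{-1} satisfies, as u → 0⁺: h(u) = -√(-2 log u) + (log|log u|)/(2√(-2 log u)) + (log π)/(2√(-2 log u)) + (log|log u|)²/(8(-2 log u)^{3/2}) + O(log|log u|/|log u|^{3/2}). -/
open Filter Topology Asymptotics Real MeasureTheory

lemma sn_alg (s y ℓ p K : ℝ) (hs : 4 ≤ s) (hy : 0 < y) (hℓ : 1 ≤ ℓ) (hp0 : 0 ≤ p) (hp3 : p ≤ 3)
    (hK : 0 ≤ K) (hD : |y ^ 2 - (s - (ℓ + p))| ≤ K * ℓ / s) (hq : (ℓ + p) ^ 2 ≤ s) :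
    |(-y) - (-√s + ℓ / (2 * √s) + p / (2 * √s) + ℓ ^ 2 / (8 * √s ^ 3))|
      ≤ (2 * K + 4) * (ℓ / √s ^ 3) := by
  obtain ⟨σ, hσ⟩ : ∃ σ, σ = √s := ⟨_, rfl⟩
  have hσ2 : σ ^ 2 = s := by rw [hσ]; exact Real.sq_sqrt (by linarith)
  have hσ0 : 2 ≤ σ := by rw [hσ]; exact Real.le_sqrt_of_sq_le (by linarith)
  rw [← hσ]
  subst hσ2
  obtain ⟨q, hqd⟩ : ∃ q, q = ℓ + p := ⟨_, rfl⟩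
  have hq1 : 1 ≤ q := by linarith
  have hq4 : q ≤ 4 * ℓ := by linarith
  rw [← hqd] at hD hq
  have hqσ : q ≤ σ := abs_le_of_sq_le_sq' hq (by linarith) |>.2
  have hσp : 0 < σ := by linarith
  obtain ⟨z, hz⟩ : ∃ z, z = σ - q / (2 * σ) - q ^ 2 / (8 * σ ^ 3) := ⟨_, rfl⟩
  have hz2 : z ^ 2 = σ ^ 2 - q + q ^ 3 / (8 * σ ^ 4) + q ^ 4 / (64 * σ ^ 6) := by
    rw [hz]; field_simp; ring
  have h1 : q / (2 * σ) ≤ 1 / 2 := by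
    rw [div_le_div_iff₀ (by positivity) (by norm_num)]; linarith
  have h2 : q ^ 2 / (8 * σ ^ 3) ≤ 1 / 16 := by
    rw [div_le_div_iff₀ (by positivity) (by norm_num)]
    nlinarith [sq_nonneg σ, mul_le_mul_of_nonneg_left hσ0 (sq_nonneg σ)]
  have hzσ : σ / 2 ≤ z := by rw [hz]; linarith
  have h3 : q ^ 3 / (8 * σ ^ 4) ≤ (1 / 2) * (ℓ / σ ^ 2) := by
    have : q ^ 3 / (8 * σ ^ 4) ≤ (4 * ℓ) * σ ^ 2 / (8 * σ ^ 4) := by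
      gcongr
      calc q ^ 3 = q * q ^ 2 := by ring
        _ ≤ _ := by gcongr
    refine this.trans (le_of_eq ?_)
    field_simp; ring
  have h4 : q ^ 4 / (64 * σ ^ 6) ≤ (1 / 2) * (ℓ / σ ^ 2) := by
    have : q ^ 4 / (64 * σ ^ 6) ≤ (4 * ℓ) * (σ ^ 2 * σ ^ 2) / (64 * σ ^ 6) := by
      gcongr
      calc q ^ 4 = q * (q ^ 2 * q) := by ring
        _ ≤ (4 * ℓ) * (σ ^ 2 * σ ^ 2) := by
          gcongr
          nlinarith
    refine this.trans ?_
    have : (4 * ℓ) * (σ ^ 2 * σ ^ 2) / (64 * σ ^ 6) = (1 / 16) * (ℓ / σ ^ 2) := by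
      field_simp; ring
    rw [this]
    have : 0 ≤ ℓ / σ ^ 2 := by positivity
    linarith
  have h3' : 0 ≤ q ^ 3 / (8 * σ ^ 4) := by positivity
  have h4' : 0 ≤ q ^ 4 / (64 * σ ^ 6) := by positivity
  have hdiff : |y ^ 2 - z ^ 2| ≤ (K + 1) * (ℓ / σ ^ 2) := by
    rw [mul_div_assoc] at hD
    rw [hz2]
    rw [abs_le] at hD ⊢
    constructor <;> nlinarith [hD.1, hD.2]
  have hyz : |y - z| ≤ (2 * K + 2) * (ℓ / σ ^ 3) := by
    have e : |y - z| * (y + z) = |y ^ 2 - z ^ 2| := by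
      have e0 : y ^ 2 - z ^ 2 = (y - z) * (y + z) := by ring
      rw [e0, abs_mul, abs_of_pos (show 0 < y + z by linarith)]
    have : |y - z| * (σ / 2) ≤ (K + 1) * (ℓ / σ ^ 2) := by
      refine le_trans ?_ (e.le.trans hdiff)
      gcongr; linarith
    rw [← mul_le_mul_iff_left₀ (show 0 < σ / 2 by linarith)]
    refine this.trans (le_of_eq ?_)
    field_simp
  have e2 : (-y) - (-σ + ℓ / (2 * σ) + p / (2 * σ) + ℓ ^ 2 / (8 * σ ^ 3))
      = -(y - z) + (2 * ℓ * p + p ^ 2) / (8 * σ ^ 3) := by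
    rw [hz, hqd]; field_simp; ring
  have h5 : (2 * ℓ * p + p ^ 2) / (8 * σ ^ 3) ≤ 2 * (ℓ / σ ^ 3) := by
    have : (2 * ℓ * p + p ^ 2) / (8 * σ ^ 3) ≤ 16 * ℓ / (8 * σ ^ 3) := by
      gcongr; nlinarith
    refine this.trans (le_of_eq ?_)
    field_simp; ring
  have h5' : 0 ≤ (2 * ℓ * p + p ^ 2) / (8 * σ ^ 3) := by positivity
  rw [e2]
  refine (abs_add_le _ _).trans ?_
  rw [abs_neg, abs_of_nonneg h5']
  linarith

lemma sn_int : Integrable (fun t : ℝ => Real.exp (-t ^ 2 / 2)) := by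
  have := integrable_exp_neg_mul_sq (b := 1/2) (by norm_num)
  refine this.congr (ae_of_all _ fun t => ?_)
  simp only; congr 1; ring

lemma sn_total : ∫ t : ℝ, Real.exp (-t ^ 2 / 2) = √(2 * π) := by
  have := integral_gaussian (1/2)
  rw [show π / (1/2) = 2 * π by ring] at this
  rw [← this]; congr 1; ext t; congr 1; ring

lemma sn_mills (x : ℝ) (hx : x < 0) :
    IntegrableOn (fun t : ℝ => Real.exp (-t ^ 2 / 2) * (1 + 1 / t ^ 2)) (Set.Iic x) ∧
    ∫ t in Set.Iic x, Real.exp (-t ^ 2 / 2) * (1 + 1 / t ^ 2) = Real.exp (-x ^ 2 / 2) / (-x) := by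
  have hint : IntegrableOn (fun t : ℝ => Real.exp (-t ^ 2 / 2) * (1 + 1 / t ^ 2)) (Set.Iic x) := by
    refine Integrable.mono' (g := fun t => Real.exp (-t ^ 2 / 2) * (1 + 1 / x ^ 2))
      (sn_int.integrableOn.mul_const _) ?_ ?_
    · exact (by fun_prop : Measurable _).aestronglyMeasurable
    · refine (ae_restrict_iff' measurableSet_Iic).2 (ae_of_all _ fun t ht => ?_)
      have ht : t ≤ x := ht
      have : x ^ 2 ≤ t ^ 2 := by nlinarith
      have hx2 : 0 < x ^ 2 := by nlinarith
      rw [Real.norm_eq_abs, abs_of_nonneg (by positivity)]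
      gcongr
  refine ⟨hint, ?_⟩
  have hd : ∀ t ∈ Set.Iic x, HasDerivAt (fun t : ℝ => Real.exp (-t ^ 2 / 2) / (-t))
      (Real.exp (-t ^ 2 / 2) * (1 + 1 / t ^ 2)) t := by
    intro t ht
    have ht : t < 0 := lt_of_le_of_lt ht hx
    have h1 : HasDerivAt (fun t : ℝ => -t ^ 2 / 2) (-t) t := by
      have h0 : HasDerivAt (fun t : ℝ => -t ^ 2 / 2) _ t :=
        ((hasDerivAt_pow 2 t).fun_neg.div_const 2)
      exact h0.congr_deriv (by push_cast; ring)
    have ht0 : t ≠ 0 := ht.ne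
    have h2 : HasDerivAt (fun t : ℝ => Real.exp (-t ^ 2 / 2) / (-t)) _ t :=
      h1.exp.fun_div (hasDerivAt_neg t) (by linarith)
    refine h2.congr_deriv ?_
    field_simp
    ring
  have hlim : Tendsto (fun t : ℝ => Real.exp (-t ^ 2 / 2) / (-t)) atBot (𝓝 0) := by
    have h0 : Tendsto (fun t : ℝ => 1 / (-t)) atBot (𝓝 0) := by
      have := (tendsto_inv_atTop_zero (𝕜 := ℝ)).comp tendsto_neg_atBot_atTop
      simpa [Function.comp_def] using this
    refine squeeze_zero' ?_ ?_ h0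
    · filter_upwards [eventually_lt_atBot 0] with t ht
      have : 0 < -t := by linarith
      positivity
    · filter_upwards [eventually_lt_atBot 0] with t ht
      have : 0 < -t := by linarith
      gcongr
      rw [Real.exp_le_one_iff]; nlinarith [sq_nonneg t]
  have := integral_Iic_of_hasDerivAt_of_tendsto' hd hint hlim
  rw [this]; ring

lemma sn_I_le (x : ℝ) (hx : x < 0) :
    ∫ t in Set.Iic x, Real.exp (-t ^ 2 / 2) ≤ Real.exp (-x ^ 2 / 2) / (-x) := by
  rw [← (sn_mills x hx).2]
  refine setIntegral_mono_on sn_int.integrableOn (sn_mills x hx).1 measurableSet_Iic fun t ht => ?_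
  refine le_mul_of_one_le_right (by positivity) ?_
  have : 0 ≤ 1 / t ^ 2 := by positivity
  linarith

lemma sn_I_ge (x : ℝ) (hx : x < 0) :
    Real.exp (-x ^ 2 / 2) / (-x) / (1 + 1 / x ^ 2) ≤ ∫ t in Set.Iic x, Real.exp (-t ^ 2 / 2) := by
  have hx2 : 0 < x ^ 2 := by nlinarith
  rw [div_le_iff₀ (by positivity), ← (sn_mills x hx).2, ← integral_mul_const]
  refine setIntegral_mono_on (sn_mills x hx).1 (sn_int.integrableOn.mul_const _) 
    measurableSet_Iic fun t ht => ?_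
  have ht : t ≤ x := ht
  have : x ^ 2 ≤ t ^ 2 := by nlinarith
  gcongr

lemma sn_Phi_mono (Φ : ℝ → ℝ)
    (hΦ : ∀ x, Φ x = ∫ t in Set.Iic x, Real.exp (-t ^ 2 / 2) / Real.sqrt (2 * Real.pi))
    : Monotone Φ := by
  intro a b hab
  rw [hΦ, hΦ]
  exact setIntegral_mono_set (sn_int.div_const _).integrableOn
    (ae_of_all _ fun t => by simp only [Pi.zero_apply]; positivity)
    (Set.Iic_subset_Iic.2 hab).eventuallyLE

lemma sn_Phi_pos (Φ : ℝ → ℝ)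
    (hΦ : ∀ x, Φ x = ∫ t in Set.Iic x, Real.exp (-t ^ 2 / 2) / Real.sqrt (2 * Real.pi))
    (x : ℝ) : 0 < Φ x := by
  have h1 := sn_Phi_mono Φ hΦ (show min x (-1) ≤ x from min_le_left _ _)
  refine lt_of_lt_of_le ?_ h1
  have hm : min x (-1) < 0 := lt_of_le_of_lt (min_le_right _ _) (by norm_num)
  rw [hΦ, integral_div]
  have := sn_I_ge _ hm
  refine div_pos (lt_of_lt_of_le ?_ this) (by positivity)
  have : 0 < - min x (-1) := by linarith
  positivity

lemma sn_Phi_le_one (Φ : ℝ → ℝ)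
    (hΦ : ∀ x, Φ x = ∫ t in Set.Iic x, Real.exp (-t ^ 2 / 2) / Real.sqrt (2 * Real.pi))
    (x : ℝ) : Φ x ≤ 1 := by
  rw [hΦ, integral_div, div_le_one (by positivity), ← sn_total]
  exact setIntegral_le_integral sn_int (ae_of_all _ fun t => by simp only [Pi.zero_apply]; positivity)

lemma sn_Phi_ge (Φ : ℝ → ℝ)
    (hΦ : ∀ x, Φ x = ∫ t in Set.Iic x, Real.exp (-t ^ 2 / 2) / Real.sqrt (2 * Real.pi))
    (x : ℝ) (hx : 0 < x) : 1 - 1 / x ^ 2 ≤ Φ x := by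
  have h1 : (∫ t in Set.Iic x, Real.exp (-t ^ 2 / 2)) + ∫ t in Set.Iic (-x), Real.exp (-t ^ 2 / 2)
      = √(2 * π) := by
    rw [← sn_total]
    have e : ∫ t in Set.Iic (-x), Real.exp (-t ^ 2 / 2) = ∫ t in Set.Ioi x, Real.exp (-t ^ 2 / 2) := by
      have := integral_comp_neg_Iic (-x) (fun t => Real.exp (-t ^ 2 / 2))
      simpa using this
    rw [e, ← Set.compl_Iic]
    exact integral_add_compl measurableSet_Iic sn_int
  have h2 := sn_I_le (-x) (by linarith)
  have h3 : Real.exp (-(-x) ^ 2 / 2) / (-(-x)) ≤ 1 / x ^ 2 := by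
    rw [neg_neg, div_le_div_iff₀ hx (by positivity)]
    have h4 : x ≤ Real.exp (x ^ 2 / 2) := by
      have := Real.add_one_le_exp (x ^ 2 / 2)
      nlinarith [sq_nonneg (x - 1)]
    have h5 : Real.exp (-(-x) ^ 2 / 2) * Real.exp (x ^ 2 / 2) = 1 := by
      rw [← Real.exp_add]; simp; ring
    have h6 : Real.exp (-(-x) ^ 2 / 2) * x ≤ 1 := by
      rw [← h5]; gcongr
    nlinarith
  have hs : 1 ≤ √(2 * π) := by
    rw [Real.one_le_sqrt]; nlinarith [Real.pi_gt_three]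
  rw [hΦ, integral_div, le_div_iff₀ (by positivity)]
  have : 0 < 1 / x ^ 2 := by positivity
  nlinarith

lemma sn_g_int (Φ : ℝ → ℝ) (l : ℝ)
    (hΦ : ∀ x, Φ x = ∫ t in Set.Iic x, Real.exp (-t ^ 2 / 2) / Real.sqrt (2 * Real.pi))
    : Integrable
    (fun t => (2 / Real.sqrt (2 * Real.pi)) * Real.exp (-t ^ 2 / 2) * Φ (l * t)) := by
  refine Integrable.mono' (sn_int.const_mul (2 / Real.sqrt (2 * Real.pi))) ?_ ?_
  · have := (sn_Phi_mono Φ hΦ).measurable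
    exact (by fun_prop : Measurable _).aestronglyMeasurable
  · refine ae_of_all _ fun t => ?_
    have h0 := sn_Phi_pos Φ hΦ (l * t)
    rw [Real.norm_eq_abs, abs_of_nonneg (by positivity)]
    exact mul_le_of_le_one_right (by positivity) (sn_Phi_le_one Φ hΦ _)

lemma sn_g_mono (Φ g : ℝ → ℝ) (l : ℝ)
    (hΦ : ∀ x, Φ x = ∫ t in Set.Iic x, Real.exp (-t ^ 2 / 2) / Real.sqrt (2 * Real.pi))
    (hg : ∀ x, g x = ∫ t in Set.Iic x,
      (2 / Real.sqrt (2 * Real.pi)) * Real.exp (-t ^ 2 / 2) * Φ (l * t))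
    : Monotone g := by
  intro a b hab
  rw [hg, hg]
  refine setIntegral_mono_set (sn_g_int Φ l hΦ).integrableOn
    (ae_of_all _ fun t => ?_)
    (Set.Iic_subset_Iic.2 hab).eventuallyLE
  have h0 := sn_Phi_pos Φ hΦ (l * t)
  simp only [Pi.zero_apply]; positivity

lemma sn_g_le (Φ g : ℝ → ℝ) (l : ℝ)
    (hΦ : ∀ x, Φ x = ∫ t in Set.Iic x, Real.exp (-t ^ 2 / 2) / Real.sqrt (2 * Real.pi))
    (hg : ∀ x, g x = ∫ t in Set.Iic x,
      (2 / Real.sqrt (2 * Real.pi)) * Real.exp (-t ^ 2 / 2) * Φ (l * t))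
    (x : ℝ) (hx : x < 0) :
    g x ≤ (2 / √(2 * π)) * (Real.exp (-x ^ 2 / 2) / (-x)) := by
  refine le_trans ?_ (mul_le_mul_of_nonneg_left (sn_I_le x hx) (by positivity))
  rw [hg, ← integral_const_mul]
  refine setIntegral_mono_on (sn_g_int Φ l hΦ).integrableOn (sn_int.const_mul _).integrableOn
    measurableSet_Iic fun t ht => ?_
  exact mul_le_of_le_one_right (by positivity) (sn_Phi_le_one Φ hΦ _)

lemma sn_g_ge (Φ g : ℝ → ℝ) (l : ℝ)
    (hΦ : ∀ x, Φ x = ∫ t in Set.Iic x, Real.exp (-t ^ 2 / 2) / Real.sqrt (2 * Real.pi))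
    (hg : ∀ x, g x = ∫ t in Set.Iic x,
      (2 / Real.sqrt (2 * Real.pi)) * Real.exp (-t ^ 2 / 2) * Φ (l * t))
    (hl : l < 0) (x : ℝ) (hx : x < 0) (hx2 : 1 / (l ^ 2 * x ^ 2) ≤ 1 / 2) :
    (2 / √(2 * π)) * (1 - 1 / (l ^ 2 * x ^ 2)) * (Real.exp (-x ^ 2 / 2) / (-x) / (1 + 1 / x ^ 2))
      ≤ g x := by
  have hc : 0 ≤ (2 / √(2 * π)) * (1 - 1 / (l ^ 2 * x ^ 2)) :=
    mul_nonneg (by positivity) (by linarith)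
  refine (mul_le_mul_of_nonneg_left (sn_I_ge x hx) hc).trans ?_
  rw [hg, ← integral_const_mul]
  refine setIntegral_mono_on (sn_int.const_mul _).integrableOn (sn_g_int Φ l hΦ).integrableOn
    measurableSet_Iic fun t ht => ?_
  have ht : t ≤ x := ht
  have h1 : l * x ≤ l * t := by nlinarith
  have h2 := sn_Phi_ge Φ hΦ (l * x) (mul_pos_of_neg_of_neg hl hx)
  have h3 := sn_Phi_mono Φ hΦ h1
  rw [mul_pow] at h2
  have : 0 ≤ (2 / √(2 * π)) * Real.exp (-t ^ 2 / 2) := by positivity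
  nlinarith [mul_le_mul_of_nonneg_left (h2.trans h3) this]

lemma sn_g_pos (Φ g : ℝ → ℝ) (l : ℝ)
    (hΦ : ∀ x, Φ x = ∫ t in Set.Iic x, Real.exp (-t ^ 2 / 2) / Real.sqrt (2 * Real.pi))
    (hg : ∀ x, g x = ∫ t in Set.Iic x,
      (2 / Real.sqrt (2 * Real.pi)) * Real.exp (-t ^ 2 / 2) * Φ (l * t))
    (hl : l < 0) (x : ℝ) : 0 < g x := by
  have hl2 : 0 < l ^ 2 := by nlinarith
  obtain ⟨m, hm0, hmx, hm2⟩ : ∃ m : ℝ, m < 0 ∧ m ≤ x ∧ 1 / (l ^ 2 * m ^ 2) ≤ 1 / 2 := by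
    refine ⟨min x (2 / l - 1), ?_, min_le_left _ _, ?_⟩
    · have : 2 / l < 0 := div_neg_of_pos_of_neg (by norm_num) hl
      exact lt_of_le_of_lt (min_le_right _ _) (by linarith)
    · have h := min_le_right x (2 / l - 1)
      set m := min x (2 / l - 1)
      have h2 : m ≤ 2 / l := by linarith
      have h3 : 2 ≤ l * m := by
        have := mul_le_mul_of_nonpos_left h2 hl.le
        rwa [mul_div_cancel₀ _ hl.ne] at this
      rw [← mul_pow]
      gcongr
      nlinarith
  refine lt_of_lt_of_le ?_ (sn_g_mono Φ g l hΦ hg hmx)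
  refine lt_of_lt_of_le ?_ (sn_g_ge Φ g l hΦ hg hl m hm0 hm2)
  have : 0 < -m := by linarith
  have : 0 < 1 - 1 / (l ^ 2 * m ^ 2) := by linarith
  positivity

/-- log form of the tail estimate -/
lemma sn_log (Φ g : ℝ → ℝ) (l : ℝ)
    (hΦ : ∀ x, Φ x = ∫ t in Set.Iic x, Real.exp (-t ^ 2 / 2) / Real.sqrt (2 * Real.pi))
    (hg : ∀ x, g x = ∫ t in Set.Iic x,
      (2 / Real.sqrt (2 * Real.pi)) * Real.exp (-t ^ 2 / 2) * Φ (l * t))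
    (hl : l < 0) (y : ℝ) (hy : 0 < y) (hx2 : 1 / (l ^ 2 * y ^ 2) ≤ 1 / 2) :
    ∃ r, -2 * Real.log (g (-y)) = y ^ 2 + Real.log (y ^ 2) + Real.log (π / 2) + r ∧ 0 ≤ r ∧
      r ≤ (4 / l ^ 2 + 2) / y ^ 2 := by
  refine ⟨-2 * Real.log (g (-y)) - (y ^ 2 + Real.log (y ^ 2) + Real.log (π / 2)), by ring, ?_⟩
  have hl2 : 0 < l ^ 2 := by nlinarith
  have hgp := sn_g_pos Φ g l hΦ hg hl (-y)
  have h1 := sn_g_le Φ g l hΦ hg (-y) (by linarith)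
  have h2 := sn_g_ge Φ g l hΦ hg hl (-y) (by linarith) (by simpa using hx2)
  rw [neg_sq, neg_neg] at h1 h2
  have hw : 0 < 1 - 1 / (l ^ 2 * y ^ 2) := by linarith
  have hc : Real.log (2 / √(2 * π)) = -(1 / 2) * Real.log (π / 2) := by
    rw [Real.log_div (by norm_num) (by positivity), Real.log_sqrt (by positivity),
      Real.log_mul (by norm_num) (by positivity), Real.log_div (by positivity) (by norm_num)]
    ring
  have hB : Real.log ((2 / √(2 * π)) * (Real.exp (-y ^ 2 / 2) / y))
      = -(1 / 2) * Real.log (π / 2) - y ^ 2 / 2 - Real.log (y ^ 2) / 2 := by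
    rw [Real.log_mul (by positivity) (by positivity), hc,
      Real.log_div (Real.exp_pos _).ne' hy.ne', Real.log_exp, Real.log_pow]
    push_cast; ring
  have h1' := Real.log_le_log hgp h1
  have h2' := Real.log_le_log (by positivity) h2
  have e : (2 / √(2 * π)) * (1 - 1 / (l ^ 2 * y ^ 2)) * (Real.exp (-y ^ 2 / 2) / y / (1 + 1 / y ^ 2))
     = ((2 / √(2 * π)) * (Real.exp (-y ^ 2 / 2) / y)) * ((1 - 1 / (l ^ 2 * y ^ 2)) / (1 + 1 / y ^ 2)) := by
    ring
  rw [e, Real.log_mul (by positivity) (by positivity), Real.log_div (by positivity) (by positivity), hB] at h2'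
  rw [hB] at h1'
  have h3 : Real.log (1 + 1 / y ^ 2) ≤ 1 / y ^ 2 := by
    have := Real.log_le_sub_one_of_pos (show 0 < 1 + 1 / y ^ 2 by positivity)
    linarith
  have h4 : -(2 * (1 / (l ^ 2 * y ^ 2))) ≤ Real.log (1 - 1 / (l ^ 2 * y ^ 2)) := by
    have := Real.one_sub_inv_le_log_of_pos hw
    refine le_trans ?_ this
    set w := 1 / (l ^ 2 * y ^ 2)
    have hw0 : 0 ≤ w := by positivity
    have : (1 - w)⁻¹ ≤ 1 + 2 * w := by
      rw [inv_le_iff_one_le_mul₀ hw]; nlinarith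
    linarith
  have e3 : (4 / l ^ 2 + 2) / y ^ 2 = 4 * (1 / (l ^ 2 * y ^ 2)) + 2 * (1 / y ^ 2) := by
    field_simp
  rw [e3]
  constructor <;> linarith

lemma sn_D (s y r K : ℝ) (hK : 0 ≤ K) (hy : K + 2 ≤ y)
    (hs : s = y ^ 2 + Real.log (y ^ 2) + Real.log (π / 2) + r) (hr0 : 0 ≤ r) (hr : r ≤ K / y ^ 2)
    (hℓ : 1 ≤ Real.log (s / 2)) :
    |y ^ 2 - (s - (Real.log (s / 2) + Real.log π))| ≤ (8 + 4 * K) * Real.log (s / 2) / s := by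
  have hy0 : 0 < y := by linarith
  have hy1 : 1 ≤ y ^ 2 := by nlinarith
  have hlp : Real.log (π / 2) ≤ 1 := by
    have := Real.log_le_sub_one_of_pos (show 0 < π / 2 by positivity)
    linarith [Real.pi_lt_four]
  have hlp0 : 0 ≤ Real.log (π / 2) := Real.log_nonneg (by linarith [Real.pi_gt_three])
  have hly0 : 0 ≤ Real.log (y ^ 2) := Real.log_nonneg hy1
  have hly : Real.log (y ^ 2) ≤ 2 * y - 2 := by
    rw [Real.log_pow]; push_cast
    linarith [Real.log_le_sub_one_of_pos hy0]
  have hrK : r ≤ K := hr.trans (div_le_self hK hy1)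
  have hys : y ^ 2 ≤ s := by linarith
  have hs0 : 0 < s := by linarith
  have hs2 : s ≤ 2 * y ^ 2 := by nlinarith
  have hL : Real.log (s / 2) = Real.log s - Real.log 2 := Real.log_div hs0.ne' (by norm_num)
  have hP : Real.log (π / 2) = Real.log π - Real.log 2 := Real.log_div (by positivity) (by norm_num)
  have hA0 : Real.log (y ^ 2) ≤ Real.log s := Real.log_le_log (by positivity) hys
  have hA : Real.log s - Real.log (y ^ 2) ≤ (s - y ^ 2) / y ^ 2 := by
    rw [← Real.log_div hs0.ne' (by positivity)]
    refine (Real.log_le_sub_one_of_pos (by positivity)).trans (le_of_eq ?_)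
    field_simp
  have hl2 : Real.log 2 ≤ 1 := by
    have := Real.log_le_sub_one_of_pos (show (0:ℝ) < 2 by norm_num)
    linarith
  have hinv : ∀ a : ℝ, 0 ≤ a → a / y ^ 2 ≤ 2 * a / s := by
    intro a ha
    rw [div_le_div_iff₀ (by positivity) hs0]
    nlinarith
  obtain ⟨ℓ, hℓd⟩ : ∃ ℓ, ℓ = Real.log (s / 2) := ⟨_, rfl⟩
  rw [← hℓd] at hℓ hL ⊢
  have hsy : s - y ^ 2 ≤ (4 + K) * ℓ := by nlinarith
  have h1 : Real.log s - Real.log (y ^ 2) ≤ (8 + 4 * K) * ℓ / s := by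
    refine hA.trans ((hinv _ (by linarith)).trans ?_)
    refine div_le_div_of_nonneg_right ?_ hs0.le
    nlinarith
  have h2 : r ≤ (8 + 4 * K) * ℓ / s := by
    refine hr.trans ((hinv _ hK).trans ?_)
    refine div_le_div_of_nonneg_right ?_ hs0.le
    nlinarith
  have e : y ^ 2 - (s - (ℓ + Real.log π)) = (Real.log s - Real.log (y ^ 2)) - r := by linarith
  rw [e, abs_le]
  constructor <;> linarith

/-- Lower quantile expansion for the standard Skew-Normal distribution with
negative skewness parameter λ. -/
theorem skew_normal_quantile_expansion_neg
    (Φ g h : ℝ → ℝ) (l : ℝ) (hl : l < 0)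
    (hΦ : ∀ x, Φ x = ∫ t in Set.Iic x, Real.exp (-t ^ 2 / 2) / Real.sqrt (2 * Real.pi))
    (hg : ∀ x, g x = ∫ t in Set.Iic x,
      (2 / Real.sqrt (2 * Real.pi)) * Real.exp (-t ^ 2 / 2) * Φ (l * t))
    (hinv : ∀ u ∈ Set.Ioo (0:ℝ) 1, g (h u) = u) :
    (fun u => h u -
      (-Real.sqrt (-2 * Real.log u)
        + Real.log |Real.log u| / (2 * Real.sqrt (-2 * Real.log u))
        + Real.log Real.pi / (2 * Real.sqrt (-2 * Real.log u))
        + (Real.log |Real.log u|) ^ 2 / (8 * (-2 * Real.log u) ^ ((3:ℝ) / 2))))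
      =O[𝓝[>] (0:ℝ)]
    (fun u => Real.log |Real.log u| / |Real.log u| ^ ((3:ℝ) / 2)) := by
  have hl2 : 0 < l ^ 2 := by nlinarith
  obtain ⟨K, hKd⟩ : ∃ K, K = 4 / l ^ 2 + 2 := ⟨_, rfl⟩
  have hK : 0 ≤ K := by rw [hKd]; positivity
  obtain ⟨Y, hYd⟩ : ∃ Y, Y = max (K + 2) (-2 / l) := ⟨_, rfl⟩
  have hgY := sn_g_pos Φ g l hΦ hg hl (-Y)
  have hLtop : Tendsto (fun u : ℝ => -Real.log u) (𝓝[>] 0) atTop :=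
    tendsto_neg_atBot_atTop.comp Real.tendsto_log_nhdsGT_zero
  have ev1 : ∀ᶠ L : ℝ in atTop, 1 ≤ Real.log L := Real.tendsto_log_atTop.eventually_ge_atTop 1
  have ev2 : ∀ᶠ L : ℝ in atTop, 16 * Real.log L ^ 2 ≤ L := by
    have := (Real.isLittleO_pow_log_id_atTop (n := 2)).bound (show (0:ℝ) < 1 / 16 by norm_num)
    filter_upwards [this, eventually_ge_atTop 0] with L hL hL0
    rw [Real.norm_eq_abs, abs_of_nonneg (by positivity), id, Real.norm_eq_abs,
      abs_of_nonneg hL0] at hL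
    linarith
  refine IsBigO.of_bound (2 * (8 + 4 * K) + 4) ?_
  have hmem : ∀ᶠ u : ℝ in 𝓝[>] 0, u ∈ Set.Ioo (0:ℝ) (min 1 (g (-Y))) :=
    Ioo_mem_nhdsGT (lt_min one_pos hgY)
  filter_upwards [hmem, hLtop.eventually ev1, hLtop.eventually ev2,
    hLtop.eventually_ge_atTop 2] with u hu h1 h2 h3
  have hu1 : u < 1 := hu.2.trans_le (min_le_left _ _)
  have hug : u < g (-Y) := hu.2.trans_le (min_le_right _ _)
  have hgu := hinv u ⟨hu.1, hu1⟩
  have hhY : h u < -Y := by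
    by_contra hcon
    have := sn_g_mono Φ g l hΦ hg (not_lt.1 hcon)
    linarith
  obtain ⟨y, hyd⟩ : ∃ y, y = -h u := ⟨_, rfl⟩
  have hhu : h u = -y := by linarith
  have hy1 : K + 2 ≤ y := by
    have : K + 2 ≤ Y := hYd ▸ le_max_left _ _
    linarith
  have hy2 : -2 / l ≤ y := by
    have : -2 / l ≤ Y := hYd ▸ le_max_right _ _
    linarith
  have hy0 : 0 < y := by linarith
  have hly : 1 / (l ^ 2 * y ^ 2) ≤ 1 / 2 := by
    have : l * y ≤ -2 := by
      have := mul_le_mul_of_nonpos_left hy2 hl.le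
      rwa [mul_div_cancel₀ _ hl.ne] at this
    rw [← mul_pow]
    gcongr
    nlinarith
  obtain ⟨r, hr, hr0, hrK⟩ := sn_log Φ g l hΦ hg hl y hy0 hly
  rw [← hhu, hgu] at hr
  rw [← hKd] at hrK
  obtain ⟨L, hLd⟩ : ∃ L, L = -Real.log u := ⟨_, rfl⟩
  have habs : |Real.log u| = L := by
    rw [hLd, abs_of_nonpos (by linarith)]
  have hs : -2 * Real.log u = 2 * L := by rw [hLd]; ring
  rw [habs, hs, hhu]
  rw [hs] at hr
  rw [← hLd] at h1 h2 h3
  have e2 : 2 * L / 2 = L := by ring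
  have hD := sn_D (2 * L) y r K hK hy1 hr hr0 hrK (by rw [e2]; exact h1)
  rw [e2] at hD
  have hp0 : 0 ≤ Real.log π := Real.log_nonneg (by linarith [Real.pi_gt_three])
  have hp3 : Real.log π ≤ 3 := by
    have := Real.log_le_sub_one_of_pos Real.pi_pos
    linarith [Real.pi_lt_four]
  have key := sn_alg (2 * L) y (Real.log L) (Real.log π) (8 + 4 * K) (by linarith) hy0 h1 hp0 hp3
    (by linarith) hD (by nlinarith)
  have hpow : ∀ a : ℝ, 0 ≤ a → a ^ ((3:ℝ) / 2) = √a ^ 3 := by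
    intro a ha
    rw [Real.sqrt_eq_rpow, ← Real.rpow_natCast, ← Real.rpow_mul ha]
    norm_num
  rw [hpow _ (by linarith), hpow _ (by linarith)]
  have hL0 : 0 < √L := Real.sqrt_pos.2 (by linarith)
  have hfin : Real.log L / √(2 * L) ^ 3 ≤ Real.log L / √L ^ 3 := by
    gcongr; linarith
  rw [Real.norm_eq_abs, Real.norm_eq_abs, abs_of_nonneg (show 0 ≤ Real.log L / √L ^ 3 by positivity)]
  refine key.trans ?_
  gcongr
end
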